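/- arXiv:1810.11843 — 9 statements merged into one kernel-verified Lean document; each statement's English description precedes it below -/
import Mathlib

section
/- Let n be a positive integer, β ∈ [0,1), τ := 1-√β, δ := (1-√β)², let z ∈ ℝ^n with 0 ≤ z_i ≤ β for all i, and let w ∈ [0,1]^n with Σ_{i=1}^n w_i z_i ≤ 1. For each positive integer q let P_q := {i ∈ [n] : τ^q β < z_i ≤ τ^{q-1} β} and S_q := Σ_{i∈P_q} w_i. Then for any set X ⊆ [n] such that |X ∩ P_q| ≤ ⌊δ S_q⌋ + 1 for every positive integer q, we have Σ_{i∈X} z_i ≤ 1. -/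
open Finset

/-- Every point of `(0, b]` lies in exactly one of the geometric classes
`(τ ^ (q + 1) * b, τ ^ q * b]`. -/
theorem exists_geometric_class_index {τ b : ℝ} (hτ0 : 0 < τ) (hτ1 : τ < 1) (hb : 0 < b) {x : ℝ}
    (hx0 : 0 < x) (hxb : x ≤ b) :
    ∃ k : ℕ, ∀ q : ℕ, (τ ^ (q + 1) * b < x ∧ x ≤ τ ^ q * b) ↔ k = q := by
  obtain ⟨k, hk, hk'⟩ := exists_nat_pow_near_of_lt_one (div_pos hx0 hb)
    ((div_le_one hb).2 hxb) hτ0 hτ1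
  rw [lt_div_iff₀ hb] at hk
  rw [div_le_iff₀ hb] at hk'
  have anti {a c : ℕ} (hac : a ≤ c) : τ ^ c * b ≤ τ ^ a * b :=
    mul_le_mul_of_nonneg_right (pow_le_pow_of_le_one hτ0.le hτ1.le hac) hb.le
  refine ⟨k, fun q => ⟨fun ⟨h1, h2⟩ => ?_, fun h => h ▸ ⟨hk, hk'⟩⟩⟩
  rcases lt_trichotomy k q with h | h | h
  · linarith [anti (Nat.add_one_le_iff.2 h)]
  · exact h
  · linarith [anti (Nat.add_one_le_iff.2 h)]

/-- feasibility of the selected set. With `τ = 1 - √β`,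
`δ = (1 - √β)²`, energies `z i ∈ [0, β]`, weights `w i ∈ [0, 1]` with
`∑ i, w i * z i ≤ 1`, classes `P q = {i : τ^q β < z i ≤ τ^(q-1) β}` and
`S q = ∑ i ∈ P q, w i`, any set `X` with `|X ∩ P q| ≤ ⌊δ S q⌋ + 1` for every `q ≥ 1`
satisfies `∑ i ∈ X, z i ≤ 1`. -/
theorem statement1 {n : ℕ} (hn : 0 < n) (β : ℝ) (hβ : 0 ≤ β) (hβ1 : β < 1)
    (τ δ : ℝ) (hτ : τ = 1 - Real.sqrt β) (hδ : δ = (1 - Real.sqrt β) ^ 2)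
    (z : Fin n → ℝ) (hz : ∀ i, 0 ≤ z i ∧ z i ≤ β)
    (w : Fin n → ℝ) (hw : ∀ i, 0 ≤ w i ∧ w i ≤ 1)
    (hwz : ∑ i, w i * z i ≤ 1)
    (P : ℕ → Finset (Fin n))
    (hP : ∀ q, 1 ≤ q → P q = {i | τ ^ q * β < z i ∧ z i ≤ τ ^ (q - 1) * β})
    (S : ℕ → ℝ) (hS : ∀ q, S q = ∑ i ∈ P q, w i)
    (X : Finset (Fin n))
    (hX : ∀ q, 1 ≤ q → ((X ∩ P q).card : ℤ) ≤ ⌊δ * S q⌋ + 1) :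
    ∑ i ∈ X, z i ≤ 1 := by
  rcases hβ.eq_or_lt with rfl | hβ0
  · exact (sum_nonpos fun i _ => (hz i).2).trans zero_le_one
  have hs0 : 0 < Real.sqrt β := Real.sqrt_pos.2 hβ0
  have hs1 : Real.sqrt β < 1 := by rwa [Real.sqrt_lt' one_pos, one_pow]
  have hss : Real.sqrt β * Real.sqrt β = β := Real.mul_self_sqrt hβ
  have hτ0 : 0 < τ := by linarith
  have hτ1 : τ < 1 := by linarith
  have hδτ : δ = τ * τ := by rw [hδ, hτ, sq]
  have hclass : ∀ i, ∃ k : ℕ, 0 < z i →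
      ∀ q : ℕ, (τ ^ (q + 1) * β < z i ∧ z i ≤ τ ^ q * β) ↔ k = q := by
    intro i
    by_cases h : 0 < z i
    · obtain ⟨k, hk⟩ := exists_geometric_class_index hτ0 hτ1 hβ0 h (hz i).2
      exact ⟨k, fun _ => hk⟩
    · exact ⟨0, fun h' => absurd h' h⟩
  choose k hk using hclass
  have hmem (q : ℕ) (i : Fin n) :
      i ∈ P (q + 1) ↔ τ ^ (q + 1) * β < z i ∧ z i ≤ τ ^ q * β := by
    rw [← mem_coe, hP (q + 1) (Nat.le_add_left 1 q)]
    rfl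
  have hmemk (q : ℕ) (i : Fin n) : i ∈ P (q + 1) ↔ 0 < z i ∧ k i = q := by
    rw [hmem]
    constructor
    · intro h
      have hzi : 0 < z i := lt_trans (by positivity) h.1
      exact ⟨hzi, (hk i hzi q).1 h⟩
    · rintro ⟨hzi, hq⟩
      exact (hk i hzi q).2 hq
  let N := univ.sup k + 1
  have hkN (i : Fin n) : k i ∈ range N :=
    mem_range.2 (Nat.lt_succ_of_le (le_sup (mem_univ i)))
  have hfiber (A : Finset (Fin n)) (f : Fin n → ℝ) :
      ∑ q ∈ range N, ∑ i ∈ A ∩ P (q + 1), f i = ∑ i ∈ A with 0 < z i, f i := by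
    rw [← sum_fiberwise_of_maps_to (s := A.filter (0 < z ·)) fun i _ => hkN i]
    refine sum_congr rfl fun q _ => sum_congr ?_ fun _ _ => rfl
    ext i
    simp only [mem_inter, mem_filter, hmemk, and_assoc]
  have hfilter (A : Finset (Fin n)) (f : Fin n → ℝ) (hf : ∀ i, z i = 0 → f i = 0) :
      ∑ i ∈ A with 0 < z i, f i = ∑ i ∈ A, f i :=
    sum_filter_of_ne fun i _ hi => (hz i).1.lt_of_ne fun h => hi (hf i h.symm)
  have hbound (q : ℕ) : ∑ i ∈ X ∩ P (q + 1), z i ≤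
      τ * ∑ i ∈ univ ∩ P (q + 1), w i * z i + β * τ ^ q := by
    have hcard : ((X ∩ P (q + 1)).card : ℝ) ≤ δ * S (q + 1) + 1 := by
      have h : ((X ∩ P (q + 1)).card : ℝ) ≤ (⌊δ * S (q + 1)⌋ : ℝ) + 1 := by
        exact_mod_cast hX (q + 1) (Nat.le_add_left 1 q)
      linarith [Int.floor_le (δ * S (q + 1))]
    have hweight : S (q + 1) * (τ ^ (q + 1) * β) ≤ ∑ i ∈ P (q + 1), w i * z i := by
      rw [hS, sum_mul]
      exact sum_le_sum fun i hi =>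
        mul_le_mul_of_nonneg_left ((hmem q i).1 hi).1.le (hw i).1
    rw [univ_inter]
    calc ∑ i ∈ X ∩ P (q + 1), z i ≤ (X ∩ P (q + 1)).card • (τ ^ q * β) :=
          sum_le_card_nsmul _ _ _ fun i hi => ((hmem q i).1 (mem_inter.1 hi).2).2
      _ = ((X ∩ P (q + 1)).card : ℝ) * (τ ^ q * β) := nsmul_eq_mul _ _
      _ ≤ (δ * S (q + 1) + 1) * (τ ^ q * β) :=
          mul_le_mul_of_nonneg_right hcard (by positivity)
      _ = τ * (S (q + 1) * (τ ^ (q + 1) * β)) + β * τ ^ q := by rw [hδτ]; ring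
      _ ≤ τ * ∑ i ∈ P (q + 1), w i * z i + β * τ ^ q :=
          add_le_add_left (mul_le_mul_of_nonneg_left hweight hτ0.le) _
  have hgeom : β * ∑ q ∈ range N, τ ^ q ≤ Real.sqrt β := by
    have h : (∑ q ∈ range N, τ ^ q) * Real.sqrt β = 1 - τ ^ N := by
      rw [← geom_sum_mul_neg, hτ, sub_sub_cancel]
    calc β * ∑ q ∈ range N, τ ^ q
        = Real.sqrt β * ((∑ q ∈ range N, τ ^ q) * Real.sqrt β) := by
          nth_rewrite 1 [← hss]; ring
      _ ≤ Real.sqrt β * 1 :=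
          mul_le_mul_of_nonneg_left (by rw [h]; linarith [pow_pos hτ0 N]) hs0.le
      _ = Real.sqrt β := mul_one _
  calc ∑ i ∈ X, z i = ∑ q ∈ range N, ∑ i ∈ X ∩ P (q + 1), z i := by
        rw [hfiber, hfilter X z fun _ h => h]
    _ ≤ ∑ q ∈ range N, (τ * ∑ i ∈ univ ∩ P (q + 1), w i * z i + β * τ ^ q) :=
        sum_le_sum fun q _ => hbound q
    _ = τ * ∑ i, w i * z i + β * ∑ q ∈ range N, τ ^ q := by
        rw [sum_add_distrib, ← mul_sum, ← mul_sum, hfiber,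
          hfilter univ (fun i => w i * z i) fun i h => by rw [h, mul_zero]]
    _ ≤ τ * 1 + Real.sqrt β :=
        add_le_add (mul_le_mul_of_nonneg_left hwz hτ0.le) hgeom
    _ = 1 := by rw [hτ]; ring
end

section
/- The function h : 𝒫 → ℝ defined by h(γ) := δ⟨c⁺,γ⟩ + Σ_{i=1}^n c⁻_i (1 - exp(-δγ_i)) - Σ_{j=1}^n f_j(γ) is convex on the nonnegative orthant 𝒫. -/
open Finset

/-- A nonpositive multiple of `1 - exp (-δ * L x)` is convex when `L` is linear. -/
theorem convexOn_nonpos_mul_one_sub_exp_linear {E : Type*} [AddCommGroup E] [Module ℝ E]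
    {s : Set E} (hs : Convex ℝ s) {a : ℝ} (ha : a ≤ 0) (δ : ℝ) (L : E →ₗ[ℝ] ℝ) :
    ConvexOn ℝ s (fun x => a * (1 - Real.exp (-δ * L x))) := by
  have hexp : ConvexOn ℝ s (fun x => Real.exp (-δ * L x)) :=
    (convexOn_exp.comp_linearMap (-δ • L)).subset (Set.subset_univ s) hs
  have h := (hexp.smul (neg_nonneg.2 ha)).add_const a
  refine h.congr fun x _ => ?_
  simp only [Pi.add_apply, smul_eq_mul]
  ring

/-- A finite sum of convex functions is convex. -/
theorem convexOn_finset_sum {E ι : Type*} [AddCommGroup E] [Module ℝ E]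
    {s : Set E} (hs : Convex ℝ s) (t : Finset ι) {f : ι → E → ℝ}
    (hf : ∀ i ∈ t, ConvexOn ℝ s (f i)) :
    ConvexOn ℝ s (fun x => ∑ i ∈ t, f i x) := by
  classical
  induction t using Finset.induction_on with
  | empty => simpa using convexOn_const (0 : ℝ) hs
  | insert a t ha ih =>
    simp only [Finset.sum_insert ha]
    exact (hf a (Finset.mem_insert_self a t)).add
      (ih fun i hi => hf i (Finset.mem_insert_of_mem hi))

/-- convexity of `h`. Actions are indexed by `Fin n` (so action `j` of
`[n] = {1, …, n}` corresponds to index `j - 1 : Fin n`), `σ` is a permutation sorting the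
rewards in nonincreasing order, and `r_{σ(j+1)}` for `j = n` is `0` (the `dif` below).
The function
`h(γ) = δ⟨c⁺, γ⟩ + ∑ i, c⁻ i (1 - exp (-δ γ i)) - ∑ j, f j γ`, where
`f j γ = (r (σ j) - r (σ (j+1))) (1 - exp (-δ ∑_{k ≤ j} γ (σ k)))`,
is convex on the nonnegative orthant. -/
theorem statement4 {n : ℕ} (hn : 0 < n) (δ : ℝ) (hδ : 0 ≤ δ)
    (c : Fin n → ℝ) (r : Fin n → ℝ) (hr : ∀ i, 0 ≤ r i)
    (σ : Equiv.Perm (Fin n)) (hσ : ∀ j k : Fin n, j ≤ k → r (σ k) ≤ r (σ j)) :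
    ConvexOn ℝ {γ : Fin n → ℝ | ∀ i, 0 ≤ γ i}
      (fun γ : Fin n → ℝ =>
        δ * ∑ i, max 0 (c i) * γ i
          + ∑ i, min 0 (c i) * (1 - Real.exp (-δ * γ i))
          - ∑ j : Fin n,
              (r (σ j) - (if h : (j : ℕ) + 1 < n then r (σ ⟨(j : ℕ) + 1, h⟩) else 0))
                * (1 - Real.exp (-δ * ∑ k ∈ Finset.Iic j, γ (σ k)))) := by
  have hs : Convex ℝ {γ : Fin n → ℝ | ∀ i, 0 ≤ γ i} := convex_Ici (0 : Fin n → ℝ)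
  have hlin : ConvexOn ℝ {γ : Fin n → ℝ | ∀ i, 0 ≤ γ i}
      (fun γ => δ * ∑ i, max 0 (c i) * γ i) := by
    refine ((δ • ∑ i, max 0 (c i) • LinearMap.proj (R := ℝ) (φ := fun _ : Fin n => ℝ) i
      ).convexOn hs).congr fun γ _ => ?_
    simp
  have hneg : ConvexOn ℝ {γ : Fin n → ℝ | ∀ i, 0 ≤ γ i}
      (fun γ => ∑ i, min 0 (c i) * (1 - Real.exp (-δ * γ i))) :=
    convexOn_finset_sum hs _ fun i _ =>
      convexOn_nonpos_mul_one_sub_exp_linear hs (min_le_left 0 (c i)) δ (LinearMap.proj i)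
  have hreward : ConvexOn ℝ {γ : Fin n → ℝ | ∀ i, 0 ≤ γ i}
      (fun γ => ∑ j : Fin n,
        -(r (σ j) - (if h : (j : ℕ) + 1 < n then r (σ ⟨(j : ℕ) + 1, h⟩) else 0))
          * (1 - Real.exp (-δ * ∑ k ∈ Finset.Iic j, γ (σ k)))) := by
    refine convexOn_finset_sum hs _ fun j _ => ?_
    have hgap : -(r (σ j) - (if h : (j : ℕ) + 1 < n then r (σ ⟨(j : ℕ) + 1, h⟩) else 0)) ≤ 0 := by
      rw [neg_nonpos, sub_nonneg]
      split_ifs with h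
      · exact hσ j ⟨(j : ℕ) + 1, h⟩ (Nat.le_succ j)
      · exact hr (σ j)
    simpa using convexOn_nonpos_mul_one_sub_exp_linear hs hgap δ
      (∑ k ∈ Finset.Iic j, LinearMap.proj (R := ℝ) (φ := fun _ : Fin n => ℝ) (σ k))
  refine ((hlin.add hneg).add hreward).congr fun γ _ => ?_
  simp only [Pi.add_apply, neg_mul, Finset.sum_neg_distrib, sub_eq_add_neg]
end

section
/- Let X be a random subset of [n] on a probability space such that: (i) for every j ∈ [n], P({σ(1),…,σ(j)} ∩ X ≠ ∅) ≥ 1 - exp(-δ Σ_{k=1}^j w_{σ(k)}); and (ii) for every i ∈ [n], 1 - exp(-δ w_i) ≤ P(i ∈ X) ≤ δ w_i. Then the expected profit satisfies E[max_{i∈X} r_i - Σ_{i∈X} c_i] ≥ -h(w), where max over the empty set is defined to be 0. -/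
open MeasureTheory Finset
open scoped Classical

/-- A real function of a measurable random element of a finite type is integrable. -/
lemma integrable_comp_of_measurableSet_fiber {Ω α : Type*} [MeasurableSpace Ω] (μ : Measure Ω)
    [IsFiniteMeasure μ] [Finite α] (X : Ω → α) (hX : ∀ s, MeasurableSet {ω | X ω = s})
    (F : α → ℝ) : Integrable (fun ω => F (X ω)) μ := by
  let : MeasurableSpace α := ⊤
  have : DiscreteMeasurableSpace α := ⟨fun _ => trivial⟩
  have hm : Measurable X := measurable_to_countable' hX
  exact (Integrable.of_finite (μ := μ.map X) (f := F)).comp_measurable hm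

/-- The integral of the indicator of an event depending on a measurable random element of a
finite type is the probability of that event. -/
lemma integral_ite_of_measurableSet_fiber {Ω α : Type*} [MeasurableSpace Ω] (μ : Measure Ω)
    [Finite α] (X : Ω → α) (hX : ∀ s, MeasurableSet {ω | X ω = s}) (p : α → Prop)
    [DecidablePred p] :
    ∫ ω, (if p (X ω) then (1 : ℝ) else 0) ∂μ = (μ {ω | p (X ω)}).toReal := by
  let : MeasurableSpace α := ⊤
  have hm : Measurable X := measurable_to_countable' hX
  have hs : MeasurableSet {ω | p (X ω)} := hm (show MeasurableSet {a | p a} from trivial)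
  rw [← measureReal_def, ← integral_indicator_one hs]
  refine integral_congr_ae (Filter.Eventually.of_forall fun ω => ?_)
  simp [Set.indicator_apply]

lemma sum_range_sub_succ_mul_ite (g : ℕ → ℝ) (k m : ℕ) :
    ∑ j ∈ range m, (g j - g (j + 1)) * (if k ≤ j then 1 else 0)
      = if k ≤ m then g k - g m else 0 := by
  induction m with
  | zero =>
    by_cases hk : k = 0 <;> simp [hk]
  | succ m ih =>
    rw [sum_range_succ, ih]
    rcases lt_trichotomy k (m + 1) with h | h | h
    · have h1 : k ≤ m := by omega
      simp [h1, h.le]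
    · subst h
      simp
    · have h1 : ¬ k ≤ m := by omega
      have h2 : ¬ k ≤ m + 1 := by omega
      simp [h1, h2]

lemma le_biSup_of_mem_finset {n : ℕ} (r : Fin n → ℝ) (s : Finset (Fin n)) {i : Fin n}
    (hi : i ∈ s) : r i ≤ ⨆ i ∈ s, r i := by
  refine le_ciSup_of_le (Set.finite_range _).bddAbove i ?_
  rw [ciSup_pos hi]

/-- The layer-cake sum of the sorted values `r ∘ σ` over a set is at most their maximum. -/
lemma sum_sub_succ_mul_ite_le_biSup {n : ℕ} (r : Fin n → ℝ) (σ : Equiv.Perm (Fin n))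
    (s : Finset (Fin n)) :
    ∑ j : Fin n, (r (σ j) - (if h : (j : ℕ) + 1 < n then r (σ ⟨(j : ℕ) + 1, h⟩) else 0))
        * (if ∃ k ≤ j, σ k ∈ s then 1 else 0) ≤ ⨆ i ∈ s, r i := by
  by_cases hs : ∃ k, σ k ∈ s
  · obtain ⟨k, hk, hmin⟩ : ∃ k, σ k ∈ s ∧ ∀ l, σ l ∈ s → k ≤ l := by
      obtain ⟨k, hk⟩ := hs
      have hne : (univ.filter fun k => σ k ∈ s).Nonempty := ⟨k, by simpa using hk⟩
      refine ⟨_, by simpa using min'_mem _ hne, fun l hl => min'_le (univ.filter fun k => σ k ∈ s) l (by simpa using hl)⟩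
    have hiff : ∀ j, (∃ l ≤ j, σ l ∈ s) ↔ (k : ℕ) ≤ j := fun j =>
      ⟨fun ⟨l, hl, h⟩ => (hmin l h).trans hl, fun h => ⟨k, h, hk⟩⟩
    refine le_trans (le_of_eq ?_) (le_biSup_of_mem_finset r s hk)
    let g : ℕ → ℝ := fun m => if h : m < n then r (σ ⟨m, h⟩) else 0
    have hsum := sum_range_sub_succ_mul_ite g k n
    rw [← Fin.sum_univ_eq_sum_range
      (fun j => (g j - g (j + 1)) * (if (k : ℕ) ≤ j then 1 else 0)) n] at hsum
    simp only [hiff]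
    simpa [g, k.2.le] using hsum
  · have h0 : ∀ j, ¬ ∃ k ≤ j, σ k ∈ s := fun j ⟨k, _, hk⟩ => hs ⟨k, hk⟩
    have hs' : s = ∅ := eq_empty_of_forall_notMem fun i hi => hs ⟨σ.symm i, by simpa using hi⟩
    simp only [h0, if_false, mul_zero, sum_const_zero]
    simp [hs']

/-- lower bound on the expected profit. Actions are indexed by `Fin n`,
`σ` is a permutation sorting the rewards in nonincreasing order, `r_{σ(n+1)} = 0`
(the `dif` below), `c⁺ i = max 0 (c i)`, `c⁻ i = min 0 (c i)`, and
`h(γ) = δ⟨c⁺, γ⟩ + ∑ i, c⁻ i (1 - exp (-δ γ i)) - ∑ j, f j γ` with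
`f j γ = (r (σ j) - r (σ (j+1))) (1 - exp (-δ ∑_{k ≤ j} γ (σ k)))`.
If the random subset `X` satisfies the stated probability bounds then
`E[max_{i ∈ X} r i - ∑_{i ∈ X} c i] ≥ -h(w)` (the maximum over the empty set being `0`,
expressed via `⨆ i ∈ X ω, r i`, which is `0` in `ℝ` for empty `X`). -/
theorem statement7 {Ω : Type*} [MeasurableSpace Ω] (μ : Measure Ω) [IsProbabilityMeasure μ]
    {n : ℕ} (hn : 0 < n) (δ : ℝ) (hδ0 : 0 ≤ δ) (hδ1 : δ ≤ 1)
    (w : Fin n → ℝ) (hw : ∀ i, 0 ≤ w i)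
    (c : Fin n → ℝ) (r : Fin n → ℝ) (hr : ∀ i, 0 ≤ r i)
    (σ : Equiv.Perm (Fin n)) (hσ : ∀ j k : Fin n, j ≤ k → r (σ k) ≤ r (σ j))
    (X : Ω → Finset (Fin n)) (hX : ∀ s : Finset (Fin n), MeasurableSet {ω | X ω = s})
    (hprob1 : ∀ j : Fin n,
      1 - Real.exp (-δ * ∑ k ∈ Finset.Iic j, w (σ k))
        ≤ (μ {ω | ∃ k ≤ j, σ k ∈ X ω}).toReal)
    (hprob2 : ∀ i : Fin n,
      1 - Real.exp (-δ * w i) ≤ (μ {ω | i ∈ X ω}).toReal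
        ∧ (μ {ω | i ∈ X ω}).toReal ≤ δ * w i) :
    ∫ ω, ((⨆ i ∈ X ω, r i) - ∑ i ∈ X ω, c i) ∂μ
      ≥ -(δ * ∑ i, max 0 (c i) * w i
          + ∑ i, min 0 (c i) * (1 - Real.exp (-δ * w i))
          - ∑ j : Fin n,
              (r (σ j) - (if h : (j : ℕ) + 1 < n then r (σ ⟨(j : ℕ) + 1, h⟩) else 0))
                * (1 - Real.exp (-δ * ∑ k ∈ Finset.Iic j, w (σ k)))) := by
  set d : Fin n → ℝ := fun j =>
    r (σ j) - (if h : (j : ℕ) + 1 < n then r (σ ⟨(j : ℕ) + 1, h⟩) else 0) with hd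
  have hd0 : ∀ j, 0 ≤ d j := by
    intro j
    simp only [hd]
    split_ifs with h
    · exact sub_nonneg.2 (hσ _ _ (Fin.le_def.2 (Nat.le_succ _)))
    · simpa using hr (σ j)
  have hint := integrable_comp_of_measurableSet_fiber μ X hX
  have hreward : ∑ j, d j * (1 - Real.exp (-δ * ∑ k ∈ Finset.Iic j, w (σ k)))
      ≤ ∫ ω, (⨆ i ∈ X ω, r i) ∂μ := by
    calc _ ≤ ∑ j, d j * (μ {ω | ∃ k ≤ j, σ k ∈ X ω}).toReal :=
          sum_le_sum fun j _ => mul_le_mul_of_nonneg_left (hprob1 j) (hd0 j)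
      _ = ∫ ω, ∑ j, d j * (if ∃ k ≤ j, σ k ∈ X ω then 1 else 0) ∂μ := by
          rw [integral_finsetSum _ fun j _ =>
            hint fun s => d j * (if ∃ k ≤ j, σ k ∈ s then 1 else 0)]
          refine sum_congr rfl fun j _ => ?_
          rw [integral_const_mul,
            integral_ite_of_measurableSet_fiber μ X hX fun s => ∃ k ≤ j, σ k ∈ s]
      _ ≤ _ := integral_mono
          (hint fun s => ∑ j, d j * (if ∃ k ≤ j, σ k ∈ s then 1 else 0))
          (hint fun s => ⨆ i ∈ s, r i)
          fun ω => sum_sub_succ_mul_ite_le_biSup r σ (X ω)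
  have hcost : ∫ ω, ∑ i ∈ X ω, c i ∂μ
      ≤ δ * ∑ i, max 0 (c i) * w i + ∑ i, min 0 (c i) * (1 - Real.exp (-δ * w i)) := by
    calc _ = ∫ ω, ∑ i, c i * (if i ∈ X ω then 1 else 0) ∂μ := by simp
      _ = ∑ i, c i * (μ {ω | i ∈ X ω}).toReal := by
          rw [integral_finsetSum _ fun i _ => hint fun s => c i * (if i ∈ s then 1 else 0)]
          refine sum_congr rfl fun i _ => ?_
          rw [integral_const_mul, integral_ite_of_measurableSet_fiber μ X hX fun s => i ∈ s]
      _ ≤ _ := by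
          rw [mul_sum, ← sum_add_distrib]
          refine sum_le_sum fun i _ => ?_
          obtain ⟨hlow, hupp⟩ := hprob2 i
          have h1 := mul_le_mul_of_nonneg_left hupp (le_max_left 0 (c i))
          have h2 := mul_le_mul_of_nonpos_left hlow (min_le_left 0 (c i))
          have h3 : max 0 (c i) + min 0 (c i) = c i := by rw [max_add_min, zero_add]
          calc c i * (μ {ω | i ∈ X ω}).toReal
              = max 0 (c i) * (μ {ω | i ∈ X ω}).toReal
                + min 0 (c i) * (μ {ω | i ∈ X ω}).toReal := by rw [← add_mul, h3]
            _ ≤ _ := by linarith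
  rw [integral_sub (hint fun s => ⨆ i ∈ s, r i) (hint fun s => ∑ i ∈ s, c i)]
  linarith
end

section
/- The function h : ℝ^n → ℝ defined by h(γ) := δ⟨c⁺,γ⟩ + Σ_{i=1}^n c⁻_i (1 - exp(-δγ_i)) - Σ_{j=1}^n f_j(γ) is differentiable at every w ∈ ℝ^n, and its gradient at w is the vector g ∈ ℝ^n whose σ(j)-th component is g_{σ(j)} = δ (c⁺_{σ(j)} + c⁻_{σ(j)} exp(-δ w_{σ(j)}) - λ_j) for each j ∈ [n], where ε_j := exp(-δ Σ_{k=1}^j w_{σ(k)}) and λ_j := Σ_{k=j}^n (r_{σ(k)} - r_{σ(k+1)}) ε_k. -/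
open Finset

/-- One minus the exponential of a multiple of a continuous linear functional has the expected
Fréchet derivative. -/
theorem hasFDerivAt_one_sub_exp_mul {E : Type*} [NormedAddCommGroup E] [NormedSpace ℝ E]
    (a : ℝ) (L : E →L[ℝ] ℝ) (w : E) :
    HasFDerivAt (fun γ => 1 - Real.exp (-a * L γ)) ((a * Real.exp (-a * L w)) • L) w := by
  have h := ((L.hasFDerivAt (x := w)).const_mul (-a)).exp.const_sub 1
  refine h.congr_fderiv ?_
  ext v
  simp
  ring

/-- Interchange of summation over the pairs `k ≤ j` of a finite partial order. -/
theorem sum_mul_sum_Iic_eq_sum_sum_Ici_mul {ι : Type*} [Fintype ι] [PartialOrder ι]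
    [LocallyFiniteOrderTop ι] [LocallyFiniteOrderBot ι] (a b : ι → ℝ) :
    ∑ j, a j * ∑ k ∈ Finset.Iic j, b k = ∑ j, (∑ k ∈ Finset.Ici j, a k) * b j := by
  simp only [Finset.mul_sum, Finset.sum_mul]
  exact Finset.sum_comm' (by simp)

/-- the gradient of `h`. Working in `EuclideanSpace ℝ (Fin n)` (i.e.
`ℝⁿ` with the Euclidean inner product), the function
`h(γ) = δ⟨c⁺, γ⟩ + ∑ i, c⁻ i (1 - exp (-δ γ i)) - ∑ j, f j γ`, with
`f j γ = (r (σ j) - r (σ (j+1))) (1 - exp (-δ ∑_{k ≤ j} γ (σ k)))` and `r_{σ(n+1)} = 0`,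
has at every point `w` the gradient `g` whose `σ j`-th component is
`δ (c⁺ (σ j) + c⁻ (σ j) exp (-δ w (σ j)) - λ j)` where
`λ j = ∑_{k ≥ j} (r (σ k) - r (σ (k+1))) ε k` and `ε k = exp (-δ ∑_{l ≤ k} w (σ l))`. -/
theorem statement8 {n : ℕ} (hn : 0 < n) (δ : ℝ) (hδ : 0 ≤ δ)
    (c : Fin n → ℝ) (r : Fin n → ℝ) (hr : ∀ i, 0 ≤ r i)
    (σ : Equiv.Perm (Fin n)) (hσ : ∀ j k : Fin n, j ≤ k → r (σ k) ≤ r (σ j))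
    (w : EuclideanSpace ℝ (Fin n)) (g : EuclideanSpace ℝ (Fin n))
    (hg : ∀ j : Fin n,
      g (σ j)
        = δ * (max 0 (c (σ j)) + min 0 (c (σ j)) * Real.exp (-δ * w (σ j))
            - ∑ k ∈ Finset.Ici j,
                (r (σ k) - (if h : (k : ℕ) + 1 < n then r (σ ⟨(k : ℕ) + 1, h⟩) else 0))
                  * Real.exp (-δ * ∑ l ∈ Finset.Iic k, w (σ l)))) :
    HasGradientAt
      (fun γ : EuclideanSpace ℝ (Fin n) =>
        δ * ∑ i, max 0 (c i) * γ i
          + ∑ i, min 0 (c i) * (1 - Real.exp (-δ * γ i))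
          - ∑ j : Fin n,
              (r (σ j) - (if h : (j : ℕ) + 1 < n then r (σ ⟨(j : ℕ) + 1, h⟩) else 0))
                * (1 - Real.exp (-δ * ∑ k ∈ Finset.Iic j, γ (σ k))))
      g w := by
  set d : Fin n → ℝ := fun k =>
    r (σ k) - (if h : (k : ℕ) + 1 < n then r (σ ⟨(k : ℕ) + 1, h⟩) else 0)
  let p : Fin n → EuclideanSpace ℝ (Fin n) →L[ℝ] ℝ := fun i => EuclideanSpace.proj i
  let q : Fin n → EuclideanSpace ℝ (Fin n) →L[ℝ] ℝ := fun j => ∑ k ∈ Finset.Iic j, p (σ k)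
  have hq (j : Fin n) (γ : EuclideanSpace ℝ (Fin n)) :
      q j γ = ∑ k ∈ Finset.Iic j, γ (σ k) := by
    simp [q, p]
  have linear_part := (HasFDerivAt.fun_sum (u := Finset.univ) fun i _ =>
    ((p i).hasFDerivAt (x := w)).const_mul (max 0 (c i))).const_mul δ
  have neg_part := HasFDerivAt.fun_sum (u := Finset.univ) fun i _ =>
    (hasFDerivAt_one_sub_exp_mul δ (p i) w).const_mul (min 0 (c i))
  have sum_part := HasFDerivAt.fun_sum (u := Finset.univ) fun j _ =>
    (hasFDerivAt_one_sub_exp_mul δ (q j) w).const_mul (d j)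
  have key := (linear_part.add neg_part).sub sum_part
  simp only [hq] at key
  rw [hasGradientAt_iff_hasFDerivAt]
  refine key.congr_fderiv ?_
  ext v
  have swap := sum_mul_sum_Iic_eq_sum_sum_Ici_mul
    (fun j => d j * Real.exp (-δ * ∑ l ∈ Finset.Iic j, w (σ l))) (fun j => v (σ j))
  have inner_eq : inner ℝ g v = ∑ j, g (σ j) * v (σ j) := by
    rw [Equiv.sum_comp σ fun i => g i * v i]
    simp [PiLp.inner_apply, mul_comm]
  have hg' (j : Fin n) : g (σ j) * v (σ j) =
      δ * (max 0 (c (σ j)) * v (σ j))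
        + min 0 (c (σ j)) * (δ * Real.exp (-δ * w (σ j)) * v (σ j))
        - δ * ((∑ k ∈ Finset.Ici j,
            d k * Real.exp (-δ * ∑ l ∈ Finset.Iic k, w (σ l))) * v (σ j)) := by
    rw [hg j]
    ring
  rw [InnerProductSpace.toDual_apply_apply, inner_eq, Finset.sum_congr rfl fun j _ => hg' j,
    Finset.sum_sub_distrib, Finset.sum_add_distrib, ← Finset.mul_sum, ← Finset.mul_sum, ← swap,
    Equiv.sum_comp σ fun i => max 0 (c i) * v i,
    Equiv.sum_comp σ fun i => min 0 (c i) * (δ * Real.exp (-δ * w i) * v i)]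
  simp only [_root_.sub_apply, _root_.add_apply,
    _root_.smul_apply, _root_.sum_apply, smul_eq_mul, hq]
  congr 1
  rw [Finset.mul_sum]
  exact Finset.sum_congr rfl fun j _ => by ring
end

section
/- Suppose w ∈ ℝ^n has all components nonnegative, 0 ≤ r_i ≤ r̂ for all i, and |c_i| ≤ ĉ for all i. Then the vector g ∈ ℝ^n with components g_{σ(j)} = δ (c⁺_{σ(j)} + c⁻_{σ(j)} exp(-δ w_{σ(j)}) - λ_j), where ε_j := exp(-δ Σ_{k=1}^j w_{σ(k)}) and λ_j := Σ_{k=j}^n (r_{σ(k)} - r_{σ(k+1)}) ε_k, satisfies ‖g‖² ≤ n δ² (r̂ + ĉ)², where ‖·‖ is the Euclidean norm. -/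
open Finset

theorem sum_Ici_sub_next {n : ℕ} (f : Fin n → ℝ) (j : Fin n) :
    ∑ k ∈ Finset.Ici j, (f k - (if h : (k : ℕ) + 1 < n then f ⟨(k : ℕ) + 1, h⟩ else 0)) = f j := by
  let F : ℕ → ℝ := fun m => if h : m < n then f ⟨m, h⟩ else 0
  calc
    _ = ∑ k ∈ Finset.Ici j, (F (Fin.valEmbedding k) - F (Fin.valEmbedding k + 1)) := by
      simp [F]
    _ = ∑ m ∈ Finset.Ico (j : ℕ) n, (F m - F (m + 1)) := by
      rw [← Fin.map_valEmbedding_Ici, Finset.sum_map]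
    _ = F j - F n := by
      rw [← neg_sub (F n), ← Finset.sum_Ico_sub F j.isLt.le, ← Finset.sum_neg_distrib]
      simp
    _ = f j := by simp [F]

theorem abs_max_add_min_mul_le {c t : ℝ} (ht0 : 0 ≤ t) (ht1 : t ≤ 1) :
    |max 0 c + min 0 c * t| ≤ |c| := by
  rcases le_total 0 c with h | h
  · simp [h]
  · rw [max_eq_left h, min_eq_right h, zero_add, abs_mul, abs_of_nonneg ht0]
    exact mul_le_of_le_one_right (abs_nonneg c) ht1

theorem EuclideanSpace.norm_sq_le_card_mul_sq {ι : Type*} [Fintype ι] (g : EuclideanSpace ℝ ι)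
    {C : ℝ} (h : ∀ i, |g i| ≤ C) : ‖g‖ ^ 2 ≤ Fintype.card ι * C ^ 2 := by
  rw [EuclideanSpace.norm_sq_eq]
  calc
    _ ≤ ∑ _i : ι, C ^ 2 := by
      gcongr with i
      exact h i
    _ = _ := by simp

/-- bound on the gradient norm. Working in `EuclideanSpace ℝ (Fin n)`
(so `‖·‖` is the Euclidean norm), if `w` has nonnegative components, `0 ≤ r i ≤ r̂` and
`|c i| ≤ ĉ` for all `i`, then the vector `g` with components
`g (σ j) = δ (c⁺ (σ j) + c⁻ (σ j) exp (-δ w (σ j)) - λ j)`, where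
`λ j = ∑_{k ≥ j} (r (σ k) - r (σ (k+1))) ε k`, `ε k = exp (-δ ∑_{l ≤ k} w (σ l))` and
`r_{σ(n+1)} = 0`, satisfies `‖g‖² ≤ n δ² (r̂ + ĉ)²`. -/
theorem statement9 {n : ℕ} (hn : 0 < n) (δ : ℝ) (hδ : 0 ≤ δ)
    (rhat chat : ℝ) (hrhat : 0 ≤ rhat) (hchat : 0 ≤ chat)
    (c : Fin n → ℝ) (hc : ∀ i, |c i| ≤ chat)
    (r : Fin n → ℝ) (hr : ∀ i, 0 ≤ r i ∧ r i ≤ rhat)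
    (σ : Equiv.Perm (Fin n)) (hσ : ∀ j k : Fin n, j ≤ k → r (σ k) ≤ r (σ j))
    (w : EuclideanSpace ℝ (Fin n)) (hw : ∀ i, 0 ≤ w i)
    (g : EuclideanSpace ℝ (Fin n))
    (hg : ∀ j : Fin n,
      g (σ j)
        = δ * (max 0 (c (σ j)) + min 0 (c (σ j)) * Real.exp (-δ * w (σ j))
            - ∑ k ∈ Finset.Ici j,
                (r (σ k) - (if h : (k : ℕ) + 1 < n then r (σ ⟨(k : ℕ) + 1, h⟩) else 0))
                  * Real.exp (-δ * ∑ l ∈ Finset.Iic k, w (σ l)))) :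
    ‖g‖ ^ 2 ≤ n * δ ^ 2 * (rhat + chat) ^ 2 := by
  have hexp : ∀ x : ℝ, 0 ≤ x → Real.exp (-δ * x) ≤ 1 := fun x hx =>
    Real.exp_le_one_iff.mpr (by nlinarith [mul_nonneg hδ hx])
  have hdrop : ∀ k : Fin n,
      0 ≤ r (σ k) - (if h : (k : ℕ) + 1 < n then r (σ ⟨(k : ℕ) + 1, h⟩) else 0) := by
    intro k
    split_ifs with h
    · exact sub_nonneg.mpr (hσ _ _ (Fin.le_def.mpr (Nat.le_succ _)))
    · simpa using (hr (σ k)).1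
  have hbound : ∀ i, |g i| ≤ δ * (rhat + chat) := by
    intro i
    obtain ⟨j, rfl⟩ := σ.surjective i
    rw [hg j, abs_mul, abs_of_nonneg hδ]
    refine mul_le_mul_of_nonneg_left ?_ hδ
    rw [add_comm rhat]
    refine (abs_sub _ _).trans (add_le_add ?_ ?_)
    · exact (abs_max_add_min_mul_le (Real.exp_nonneg _) (hexp _ (hw _))).trans (hc _)
    · rw [abs_of_nonneg (Finset.sum_nonneg fun k _ => mul_nonneg (hdrop k) (Real.exp_nonneg _))]
      calc
        _ ≤ ∑ k ∈ Finset.Ici j,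
            (r (σ k) - (if h : (k : ℕ) + 1 < n then r (σ ⟨(k : ℕ) + 1, h⟩) else 0)) :=
          Finset.sum_le_sum fun k _ => mul_le_of_le_one_right (hdrop k)
            (hexp _ (Finset.sum_nonneg fun l _ => hw _))
        _ = r (σ j) := sum_Ici_sub_next (fun k => r (σ k)) j
        _ ≤ rhat := (hr _).2
  refine (EuclideanSpace.norm_sq_le_card_mul_sq g hbound).trans_eq ?_
  rw [Fintype.card_fin]
  ring
end

section
/- Let C ⊆ ℝ^n be a nonempty, closed, convex, bounded set, let T be a positive integer, and for each t ∈ [T] let f_t : ℝ^n → ℝ be a convex differentiable function. Let η_1 ≥ η_2 ≥ … ≥ η_T > 0. Let w_1 ∈ C and recursively define g_t := ∇f_t(w_t) and w_{t+1} := Π_C(w_t - η_t g_t), where Π_C denotes Euclidean projection onto C. Then for every φ ∈ C: Σ_{t=1}^T (f_t(w_t) - f_t(φ)) ≤ R²/(2η_T) + (1/2) Σ_{t=1}^T η_t ‖g_t‖², where R := sup_{x,y∈C} ‖x - y‖ and ‖·‖ is the Euclidean norm. -/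
open Finset

/-- First-order condition for convexity: a differentiable convex function lies above its
tangent hyperplanes. -/
theorem ConvexOn.inner_gradient_le_sub {E : Type*} [NormedAddCommGroup E]
    [InnerProductSpace ℝ E] [CompleteSpace E] {s : Set E} {f : E → ℝ} (hf : ConvexOn ℝ s f)
    {x y g : E} (hx : x ∈ s) (hy : y ∈ s) (hg : HasGradientAt f g x) :
    inner ℝ g (y - x) ≤ f y - f x := by
  have hline : ConvexOn ℝ (AffineMap.lineMap x y ⁻¹' s) (f ∘ AffineMap.lineMap (k := ℝ) x y) :=
    hf.comp_affineMap _
  have hderiv : HasDerivAt (f ∘ AffineMap.lineMap (k := ℝ) x y) (inner ℝ g (y - x)) 0 := by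
    have hfx : HasFDerivAt f (InnerProductSpace.toDual ℝ E g)
        (AffineMap.lineMap (k := ℝ) x y 0) := by
      simpa using hg.hasFDerivAt
    simpa using hfx.comp_hasDerivAt (0 : ℝ) AffineMap.hasDerivAt_lineMap
  simpa [slope_def_field] using
    hline.le_slope_of_hasDerivAt (x := 0) (y := 1) (by simpa) (by simpa) one_pos hderiv

/-- A point of a convex set `C` closest to `u` is at least as close as `u` to every point
of `C`. -/
theorem Convex.norm_sub_le_of_forall_norm_sub_le {E : Type*} [NormedAddCommGroup E]
    [InnerProductSpace ℝ E] {C : Set E} (hC : Convex ℝ C) {u p z : E} (hp : p ∈ C)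
    (hmin : ∀ y ∈ C, ‖p - u‖ ≤ ‖y - u‖) (hz : z ∈ C) : ‖p - z‖ ≤ ‖u - z‖ := by
  have : Nonempty C := ⟨⟨p, hp⟩⟩
  have hinf : ‖u - p‖ = ⨅ y : C, ‖u - y‖ :=
    le_antisymm
      (le_ciInf fun y => by simpa only [norm_sub_rev u] using hmin y y.2)
      (ciInf_le ⟨0, Set.forall_mem_range.2 fun _ => norm_nonneg _⟩ (⟨p, hp⟩ : C))
  have hobtuse := (norm_eq_iInf_iff_real_inner_le_zero hC hp).1 hinf z hz
  have hexpand : ‖u - z‖ ^ 2 = ‖u - p‖ ^ 2 - 2 * inner ℝ (u - p) (z - p) + ‖p - z‖ ^ 2 := by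
    rw [← sub_sub_sub_cancel_right u z p, norm_sub_sq_real, norm_sub_rev z p]
  refine le_of_sq_le_sq ?_ (norm_nonneg _)
  nlinarith [sq_nonneg ‖u - p‖]

/-- Regret of a single projected gradient step. -/
theorem ConvexOn.sub_le_of_projected_gradient_step {E : Type*} [NormedAddCommGroup E]
    [InnerProductSpace ℝ E] [CompleteSpace E] {C s : Set E} {f : E → ℝ} (hf : ConvexOn ℝ s f)
    (hC : Convex ℝ C) {x p z g : E} {η : ℝ} (hη : 0 < η) (hx : x ∈ s) (hzs : z ∈ s)
    (hg : HasGradientAt f g x) (hp : p ∈ C)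
    (hmin : ∀ y ∈ C, ‖p - (x - η • g)‖ ≤ ‖y - (x - η • g)‖) (hz : z ∈ C) :
    f x - f z ≤ (‖x - z‖ ^ 2 - ‖p - z‖ ^ 2) / (2 * η) + 1 / 2 * (η * ‖g‖ ^ 2) := by
  have hgrad := hf.inner_gradient_le_sub hx hzs hg
  have hproj := pow_le_pow_left₀ (norm_nonneg _) (hC.norm_sub_le_of_forall_norm_sub_le hp hmin hz) 2
  have hexpand : ‖x - η • g - z‖ ^ 2 =
      ‖x - z‖ ^ 2 + 2 * η * inner ℝ g (z - x) + η ^ 2 * ‖g‖ ^ 2 := by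
    rw [sub_right_comm, norm_sub_sq_real, real_inner_smul_right, real_inner_comm, norm_smul,
      mul_pow, Real.norm_eq_abs, sq_abs, ← neg_sub z x, inner_neg_right]
    ring
  have hdiv : -inner ℝ g (z - x) - 1 / 2 * (η * ‖g‖ ^ 2) ≤
      (‖x - z‖ ^ 2 - ‖p - z‖ ^ 2) / (2 * η) := by
    rw [le_div_iff₀ (by positivity)]
    linarith
  linarith

/-- Summation by parts bound for a telescoping sum weighted by nonincreasing step sizes. -/
theorem sum_Icc_sub_succ_div_le {T : ℕ} (hT : 1 ≤ T) {a η : ℕ → ℝ} {D : ℝ}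
    (hη : ∀ t ∈ Finset.Icc 1 T, 0 < η t)
    (hmono : ∀ s ∈ Finset.Icc 1 T, ∀ t ∈ Finset.Icc 1 T, s ≤ t → η t ≤ η s)
    (ha : ∀ t ∈ Finset.Icc 1 T, a t ≤ D) :
    ∑ t ∈ Finset.Icc 1 T, (a t - a (t + 1)) / (2 * η t) ≤ (D - a (T + 1)) / (2 * η T) := by
  induction T, hT using Nat.le_induction with
  | base =>
    have := hη 1 (by simp)
    have := ha 1 (by simp)
    simp only [Finset.Icc_self, Finset.sum_singleton]
    gcongr
  | succ T hT ih =>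
    have hsub : Finset.Icc 1 T ⊆ Finset.Icc 1 (T + 1) := Finset.Icc_subset_Icc_right T.le_succ
    have hlast : T + 1 ∈ Finset.Icc 1 (T + 1) := by simp
    have hprev : T ∈ Finset.Icc 1 (T + 1) := by simp [hT]
    have hbound := ih (fun t ht => hη t (hsub ht))
      (fun s hs t ht => hmono s (hsub hs) t (hsub ht)) (fun t ht => ha t (hsub ht))
    have hstep : (D - a (T + 1)) / (2 * η T) ≤ (D - a (T + 1)) / (2 * η (T + 1)) :=
      div_le_div_of_nonneg_left (sub_nonneg.2 (ha _ hlast)) (by linarith [hη _ hlast])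
        (by linarith [hmono _ hprev _ hlast T.le_succ])
    rw [Finset.sum_Icc_succ_top (by lia)]
    calc _ ≤ (D - a (T + 1)) / (2 * η (T + 1))
          + (a (T + 1) - a (T + 1 + 1)) / (2 * η (T + 1)) := by linarith
      _ = _ := by ring

/-- online gradient descent regret bound, nonincreasing learning
rates. Working in `EuclideanSpace ℝ (Fin n)` (so `‖·‖` is the Euclidean norm and
`R = Metric.diam C = sup_{x, y ∈ C} ‖x - y‖`): if `C` is nonempty, closed, convex and
bounded, each `f t` is convex and differentiable with gradient `g t` at `w t`,
`η 1 ≥ η 2 ≥ … ≥ η T > 0`, `w 1 ∈ C`, and each `w (t+1)` is the Euclidean projection of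
`w t - η t • g t` onto `C` (characterised as the point of `C` closest to it), then for
every `φ ∈ C` the regret satisfies
`∑ t, (f t (w t) - f t φ) ≤ R² / (2 η T) + (1/2) ∑ t, η t ‖g t‖²`. -/
theorem statement10 {n : ℕ} (hn : 0 < n) {T : ℕ} (hT : 0 < T)
    (C : Set (EuclideanSpace ℝ (Fin n)))
    (hCne : C.Nonempty) (hCclosed : IsClosed C) (hCconvex : Convex ℝ C)
    (hCbdd : Bornology.IsBounded C)
    (f : ℕ → EuclideanSpace ℝ (Fin n) → ℝ)
    (hfconv : ∀ t ∈ Finset.Icc 1 T, ConvexOn ℝ Set.univ (f t))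
    (hfdiff : ∀ t ∈ Finset.Icc 1 T, Differentiable ℝ (f t))
    (η : ℕ → ℝ) (hηpos : ∀ t ∈ Finset.Icc 1 T, 0 < η t)
    (hηmono : ∀ s ∈ Finset.Icc 1 T, ∀ t ∈ Finset.Icc 1 T, s ≤ t → η t ≤ η s)
    (w g : ℕ → EuclideanSpace ℝ (Fin n))
    (hw1 : w 1 ∈ C)
    (hg : ∀ t ∈ Finset.Icc 1 T, HasGradientAt (f t) (g t) (w t))
    (hproj : ∀ t ∈ Finset.Icc 1 T, w (t + 1) ∈ C ∧
      ∀ y ∈ C, ‖w (t + 1) - (w t - η t • g t)‖ ≤ ‖y - (w t - η t • g t)‖)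
    (φ : EuclideanSpace ℝ (Fin n)) (hφ : φ ∈ C) :
    ∑ t ∈ Finset.Icc 1 T, (f t (w t) - f t φ)
      ≤ Metric.diam C ^ 2 / (2 * η T)
        + (1 / 2) * ∑ t ∈ Finset.Icc 1 T, η t * ‖g t‖ ^ 2 := by
  have hw : ∀ t ∈ Finset.Icc 1 T, w t ∈ C := by
    intro t ht
    obtain ⟨h1, hle⟩ := Finset.mem_Icc.1 ht
    obtain rfl | hlt := h1.eq_or_lt
    · exact hw1
    · obtain ⟨s, rfl⟩ := Nat.exists_eq_add_of_lt hlt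
      exact (hproj (1 + s) (Finset.mem_Icc.2 (by lia))).1
  have hdist : ∀ t ∈ Finset.Icc 1 T, ‖w t - φ‖ ^ 2 ≤ Metric.diam C ^ 2 := fun t ht =>
    pow_le_pow_left₀ (norm_nonneg _)
      (by simpa [dist_eq_norm] using Metric.dist_le_diam_of_mem hCbdd (hw t ht) hφ) 2
  have hηT : 0 < η T := hηpos T (Finset.mem_Icc.2 ⟨hT, le_rfl⟩)
  calc ∑ t ∈ Finset.Icc 1 T, (f t (w t) - f t φ)
      ≤ ∑ t ∈ Finset.Icc 1 T, ((‖w t - φ‖ ^ 2 - ‖w (t + 1) - φ‖ ^ 2) / (2 * η t)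
          + 1 / 2 * (η t * ‖g t‖ ^ 2)) :=
        Finset.sum_le_sum fun t ht =>
          (hfconv t ht).sub_le_of_projected_gradient_step hCconvex (hηpos t ht) trivial trivial
            (hg t ht) (hproj t ht).1 (hproj t ht).2 hφ
    _ = ∑ t ∈ Finset.Icc 1 T, (‖w t - φ‖ ^ 2 - ‖w (t + 1) - φ‖ ^ 2) / (2 * η t)
          + 1 / 2 * ∑ t ∈ Finset.Icc 1 T, η t * ‖g t‖ ^ 2 := by
        rw [Finset.sum_add_distrib, Finset.mul_sum]
    _ ≤ (Metric.diam C ^ 2 - ‖w (T + 1) - φ‖ ^ 2) / (2 * η T)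
          + 1 / 2 * ∑ t ∈ Finset.Icc 1 T, η t * ‖g t‖ ^ 2 := by
        gcongr
        exact sum_Icc_sub_succ_div_le (a := fun t => ‖w t - φ‖ ^ 2) hT hηpos hηmono hdist
    _ ≤ Metric.diam C ^ 2 / (2 * η T)
          + 1 / 2 * ∑ t ∈ Finset.Icc 1 T, η t * ‖g t‖ ^ 2 := by
        gcongr
        exact sub_le_self _ (sq_nonneg _)
end

section
/- Let g_1, …, g_T be nonzero vectors in ℝ^n with ‖g_t‖² ≤ n δ² (r̂ + ĉ)² for all t ∈ [T], define η'_t := min_{t' ≤ t} (√n / ‖g_{t'}‖) and η_t := η'_t / √(2t), and let R ≥ 0 satisfy R² ≤ n. Then R²/(2η_T) + (1/2) Σ_{t=1}^T η_t ‖g_t‖² ≤ n √(2T) δ (r̂ + ĉ), where ‖·‖ is the Euclidean norm. -/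
open Finset

/-- Integral-type bound on the partial sums of `1 / √(2t)`. -/
theorem sum_Icc_inv_sqrt_two_mul_le (T : ℕ) :
    ∑ t ∈ Finset.Icc 1 T, (Real.sqrt (2 * t))⁻¹ ≤ Real.sqrt (2 * T) := by
  induction T with
  | zero => simp
  | succ k ih =>
    rw [Finset.sum_Icc_succ_top (by omega)]
    have ha : Real.sqrt (2 * (k : ℝ)) ^ 2 = 2 * k := Real.sq_sqrt (by positivity)
    have hb : Real.sqrt (2 * ((k + 1 : ℕ) : ℝ)) ^ 2 = 2 * ((k + 1 : ℕ) : ℝ) :=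
      Real.sq_sqrt (by positivity)
    have hbpos : 0 < Real.sqrt (2 * ((k + 1 : ℕ) : ℝ)) := Real.sqrt_pos.2 (by positivity)
    set a := Real.sqrt (2 * (k : ℝ))
    set b := Real.sqrt (2 * ((k + 1 : ℕ) : ℝ))
    push_cast at hb
    have hinv : b⁻¹ ≤ b - a := by
      rw [inv_le_iff_one_le_mul₀ hbpos]
      nlinarith [sq_nonneg (b - a)]
    linarith

/-- With nonzero gradients satisfying `‖g t‖² ≤ n δ² (r̂ + ĉ)²`,
learning rates `η' t = min_{t' ≤ t} (√n / ‖g t'‖)` (expressed via `IsLeast`) and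
`η t = η' t / √(2t)`, and `R ≥ 0` with `R² ≤ n`, one has
`R² / (2 η T) + (1/2) ∑_{t=1}^T η t ‖g t‖² ≤ n √(2T) δ (r̂ + ĉ)`. The norm is the
Euclidean norm on `EuclideanSpace ℝ (Fin n)`. -/
theorem statement13 {n T : ℕ} (hn : 0 < n) (hT : 0 < T)
    (δ rhat chat : ℝ) (hδ : 0 ≤ δ) (hrhat : 0 ≤ rhat) (hchat : 0 ≤ chat)
    (g : ℕ → EuclideanSpace ℝ (Fin n)) (hg : ∀ t ∈ Finset.Icc 1 T, g t ≠ 0)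
    (hgbound : ∀ t ∈ Finset.Icc 1 T, ‖g t‖ ^ 2 ≤ n * δ ^ 2 * (rhat + chat) ^ 2)
    (η' : ℕ → ℝ)
    (hη' : ∀ t ∈ Finset.Icc 1 T,
      IsLeast {x : ℝ | ∃ t' ∈ Finset.Icc 1 t, x = Real.sqrt n / ‖g t'‖} (η' t))
    (η : ℕ → ℝ) (hη : ∀ t ∈ Finset.Icc 1 T, η t = η' t / Real.sqrt (2 * t))
    (R : ℝ) (hR : 0 ≤ R) (hRn : R ^ 2 ≤ n) :
    R ^ 2 / (2 * η T) + (1 / 2) * ∑ t ∈ Finset.Icc 1 T, η t * ‖g t‖ ^ 2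
      ≤ n * Real.sqrt (2 * T) * δ * (rhat + chat) := by
  have hS : 0 < Real.sqrt n := Real.sqrt_pos.2 (by exact_mod_cast hn)
  have hSS : Real.sqrt n * Real.sqrt n = n := Real.mul_self_sqrt (by positivity)
  have hB : 0 ≤ δ * (rhat + chat) := by positivity
  have hnorm : ∀ t ∈ Finset.Icc 1 T, ‖g t‖ ≤ Real.sqrt n * (δ * (rhat + chat)) := by
    intro t ht
    refine (sq_le_sq₀ (norm_nonneg _) (by positivity)).1 ?_
    calc ‖g t‖ ^ 2 ≤ n * δ ^ 2 * (rhat + chat) ^ 2 := hgbound t ht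
      _ = (Real.sqrt n * (δ * (rhat + chat))) ^ 2 := by rw [mul_pow, pow_two (Real.sqrt n), hSS]; ring
  have hTmem : T ∈ Finset.Icc 1 T := Finset.mem_Icc.2 ⟨hT, le_rfl⟩
  have hdist : R ^ 2 / (2 * η T) ≤ n * Real.sqrt (2 * T) * (δ * (rhat + chat)) / 2 := by
    obtain ⟨⟨s, hs, hsη⟩, -⟩ := hη' T hTmem
    have hgs : 0 < ‖g s‖ := norm_pos_iff.2 (hg s hs)
    have hsqrt : 0 < Real.sqrt (2 * T) := Real.sqrt_pos.2 (by positivity)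
    calc R ^ 2 / (2 * η T) = R ^ 2 * (Real.sqrt (2 * T) * (‖g s‖ / Real.sqrt n) / 2) := by
          rw [hη T hTmem, hsη]
          field_simp
      _ ≤ n * (Real.sqrt (2 * T) * (δ * (rhat + chat)) / 2) := by
          gcongr
          exact (div_le_iff₀' hS).2 (hnorm s hs)
      _ = n * Real.sqrt (2 * T) * (δ * (rhat + chat)) / 2 := by ring
  have hterm : ∀ t ∈ Finset.Icc 1 T,
      η t * ‖g t‖ ^ 2 ≤ n * (δ * (rhat + chat)) * (Real.sqrt (2 * t))⁻¹ := by
    intro t ht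
    have hgt : 0 < ‖g t‖ := norm_pos_iff.2 (hg t ht)
    have hle : η' t ≤ Real.sqrt n / ‖g t‖ :=
      (hη' t ht).2 ⟨t, Finset.mem_Icc.2 ⟨(Finset.mem_Icc.1 ht).1, le_rfl⟩, rfl⟩
    calc η t * ‖g t‖ ^ 2 = η' t * ‖g t‖ ^ 2 * (Real.sqrt (2 * t))⁻¹ := by
          rw [hη t ht]; ring
      _ ≤ Real.sqrt n / ‖g t‖ * ‖g t‖ ^ 2 * (Real.sqrt (2 * t))⁻¹ := by gcongr
      _ = Real.sqrt n * ‖g t‖ * (Real.sqrt (2 * t))⁻¹ := by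
          congr 1
          field_simp
      _ ≤ Real.sqrt n * (Real.sqrt n * (δ * (rhat + chat))) * (Real.sqrt (2 * t))⁻¹ := by
          gcongr
          exact hnorm t ht
      _ = n * (δ * (rhat + chat)) * (Real.sqrt (2 * t))⁻¹ := by rw [← mul_assoc, hSS]
  have hsum : ∑ t ∈ Finset.Icc 1 T, η t * ‖g t‖ ^ 2
      ≤ n * (δ * (rhat + chat)) * Real.sqrt (2 * T) := by
    refine (Finset.sum_le_sum hterm).trans ?_
    rw [← Finset.mul_sum]
    gcongr
    exact sum_Icc_inv_sqrt_two_mul_le T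
  linarith
end

section
/- Let S ⊆ [n] be nonempty, let φ ∈ ℝ^n be its indicator vector (φ_i = 1 if i ∈ S, φ_i = 0 otherwise), and set α := 1 - e^{-δ}. Define the discounted profit D_{α,δ}(S) := α max_{i∈S} r_i - α Σ_{i∈S} c⁻_i - δ Σ_{i∈S} c⁺_i. Then D_{α,δ}(S) ≤ -h(φ). -/
open Finset
open scoped Classical

/-- The tail of a telescoping sum of decrements, starting at index `m`. -/
theorem sum_ite_sub_succ (R : ℕ → ℝ) {m n : ℕ} (hm : m ≤ n) :
    ∑ j : Fin n, (if m ≤ (j : ℕ) then R j - R (j + 1) else 0) = R m - R n := by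
  rw [Fin.sum_univ_eq_sum_range (fun j => if m ≤ j then R j - R (j + 1) else 0)]
  have key := Finset.sum_range_sub' (fun k => R (max k m)) n
  simp only [Nat.zero_max, max_eq_left hm] at key
  rw [← key]
  refine Finset.sum_congr rfl fun j _ => ?_
  split_ifs with h
  · rw [max_eq_left h, max_eq_left (by omega)]
  · rw [max_eq_right (by omega), max_eq_right (by omega), sub_self]

/-- Actions are indexed by `Fin n`, `σ` is a permutation sorting the
rewards in nonincreasing order, `r_{σ(n+1)} = 0` (the `dif` below), `c⁺ i = max 0 (c i)`,
`c⁻ i = min 0 (c i)`, and `h(γ) = δ⟨c⁺, γ⟩ + ∑ i, c⁻ i (1 - exp (-δ γ i)) - ∑ j, f j γ`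
with `f j γ = (r (σ j) - r (σ (j+1))) (1 - exp (-δ ∑_{k ≤ j} γ (σ k)))`. For a nonempty
`S ⊆ [n]` with indicator vector `φ` and `α = 1 - e^{-δ}`, the discounted profit
`D_{α,δ}(S) = α max_{i ∈ S} r i - α ∑_{i ∈ S} c⁻ i - δ ∑_{i ∈ S} c⁺ i` satisfies
`D_{α,δ}(S) ≤ -h(φ)`. -/
theorem statement14 {n : ℕ} (hn : 0 < n) (δ : ℝ) (hδ : 0 ≤ δ)
    (c : Fin n → ℝ) (r : Fin n → ℝ) (hr : ∀ i, 0 ≤ r i)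
    (σ : Equiv.Perm (Fin n)) (hσ : ∀ j k : Fin n, j ≤ k → r (σ k) ≤ r (σ j))
    (S : Finset (Fin n)) (hS : S.Nonempty)
    (φ : Fin n → ℝ) (hφ : ∀ i, φ i = if i ∈ S then 1 else 0)
    (α : ℝ) (hα : α = 1 - Real.exp (-δ)) :
    α * S.sup' hS r - α * ∑ i ∈ S, min 0 (c i) - δ * ∑ i ∈ S, max 0 (c i)
      ≤ -(δ * ∑ i, max 0 (c i) * φ i
          + ∑ i, min 0 (c i) * (1 - Real.exp (-δ * φ i))
          - ∑ j : Fin n,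
              (r (σ j) - (if h : (j : ℕ) + 1 < n then r (σ ⟨(j : ℕ) + 1, h⟩) else 0))
                * (1 - Real.exp (-δ * ∑ k ∈ Finset.Iic j, φ (σ k)))) := by
  obtain ⟨i, hi, hmax⟩ := S.exists_mem_eq_sup' hS r
  obtain ⟨m, rfl⟩ := σ.surjective i
  have hφ0 : ∀ i, 0 ≤ φ i := fun i => by rw [hφ]; split_ifs <;> norm_num
  have hpos : ∑ i, max 0 (c i) * φ i = ∑ i ∈ S, max 0 (c i) := by
    simp [hφ]
  have hneg : ∑ i, min 0 (c i) * (1 - Real.exp (-δ * φ i)) = α * ∑ i ∈ S, min 0 (c i) := by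
    rw [← Finset.sum_filter_add_sum_filter_not Finset.univ (· ∈ S),
      Finset.sum_eq_zero (s := Finset.univ.filter (· ∉ S)), Finset.mul_sum, add_zero]
    · refine Finset.sum_congr (by ext; simp) fun i hi => ?_
      rw [hφ, if_pos hi, hα, mul_one, mul_comm]
    · intro i hi
      rw [hφ, if_neg (by simpa using hi)]
      simp
  let R : ℕ → ℝ := fun k => if h : k < n then r (σ ⟨k, h⟩) else 0
  have hRfin : ∀ j : Fin n, R j = r (σ j) := fun j => by simp [R]
  have hRn : R n = 0 := by simp [R]
  have hRanti : ∀ j : Fin n, R (j + 1) ≤ R j := by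
    intro j
    rw [hRfin]
    by_cases h : (j : ℕ) + 1 < n
    · simp only [R, dif_pos h]
      exact hσ _ _ (Fin.le_def.2 (Nat.le_succ _))
    · simp only [R, dif_neg h]
      exact hr _
  have hmain : α * r (σ m) ≤ ∑ j : Fin n,
      (r (σ j) - (if h : (j : ℕ) + 1 < n then r (σ ⟨(j : ℕ) + 1, h⟩) else 0))
        * (1 - Real.exp (-δ * ∑ k ∈ Finset.Iic j, φ (σ k))) := by
    have htel := sum_ite_sub_succ R m.is_lt.le
    rw [hRn, sub_zero, hRfin] at htel
    rw [← htel, Finset.mul_sum]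
    refine Finset.sum_le_sum fun j _ => ?_
    change _ ≤ (r (σ j) - R (j + 1)) * _
    rw [← hRfin]
    have hd : 0 ≤ R j - R (j + 1) := sub_nonneg.2 (hRanti j)
    have hsum : 0 ≤ ∑ k ∈ Finset.Iic j, φ (σ k) := Finset.sum_nonneg fun k _ => hφ0 _
    split_ifs with hmj
    · have hone : 1 ≤ ∑ k ∈ Finset.Iic j, φ (σ k) := by
        have := Finset.single_le_sum (f := fun k => φ (σ k)) (fun k _ => hφ0 (σ k))
          (Finset.mem_Iic.2 (Fin.le_def.2 hmj))
        simpa only [hφ (σ m), if_pos hi] using this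
      rw [mul_comm, hα]
      refine mul_le_mul_of_nonneg_left (sub_le_sub_left (Real.exp_le_exp.2 ?_) 1) hd
      nlinarith
    · rw [mul_zero]
      refine mul_nonneg hd (sub_nonneg.2 (Real.exp_le_one_iff.2 ?_))
      nlinarith
  rw [hmax, hpos, hneg]
  linarith
end

section
/- Let S ⊆ [n] be nonempty and let φ ∈ ℝ^n be its indicator vector (φ_i = 1 if i ∈ S, φ_i = 0 otherwise). Then Σ_{j=1}^n f_j(φ) ≥ (1 - e^{-δ}) max_{i∈S} r_i. -/
open Finset
open scoped Classical

/-- A tail of a sequence of consecutive differences, summed over `Fin n`, telescopes. -/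
theorem sum_fin_ite_sub_succ {n m : ℕ} (hm : m ≤ n) (g : ℕ → ℝ) :
    ∑ j : Fin n, (if m ≤ (j : ℕ) then g j - g (j + 1) else 0) = g m - g n := by
  rw [Fin.sum_univ_eq_sum_range (fun j => if m ≤ j then g j - g (j + 1) else 0) n,
    ← Finset.sum_filter]
  have hfilter : (Finset.range n).filter (fun j => m ≤ j) = Finset.Ico m n := by
    ext j
    simp only [Finset.mem_filter, Finset.mem_range, Finset.mem_Ico]
    omega
  rw [hfilter, ← neg_inj, ← Finset.sum_neg_distrib]
  simpa using Finset.sum_Ico_sub g hm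

/-- Actions are indexed by `Fin n`, `σ` is a permutation sorting the
rewards in nonincreasing order, `r_{σ(n+1)} = 0` (the `dif` below), and
`f j γ = (r (σ j) - r (σ (j+1))) (1 - exp (-δ ∑_{k ≤ j} γ (σ k)))`. For a nonempty
`S ⊆ [n]` with indicator vector `φ`, one has `∑ j, f j φ ≥ (1 - e^{-δ}) max_{i ∈ S} r i`. -/
theorem statement16 {n : ℕ} (hn : 0 < n) (δ : ℝ) (hδ : 0 ≤ δ)
    (r : Fin n → ℝ) (hr : ∀ i, 0 ≤ r i)
    (σ : Equiv.Perm (Fin n)) (hσ : ∀ j k : Fin n, j ≤ k → r (σ k) ≤ r (σ j))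
    (S : Finset (Fin n)) (hS : S.Nonempty)
    (φ : Fin n → ℝ) (hφ : ∀ i, φ i = if i ∈ S then 1 else 0) :
    ∑ j : Fin n,
        (r (σ j) - (if h : (j : ℕ) + 1 < n then r (σ ⟨(j : ℕ) + 1, h⟩) else 0))
          * (1 - Real.exp (-δ * ∑ k ∈ Finset.Iic j, φ (σ k)))
      ≥ (1 - Real.exp (-δ)) * S.sup' hS r := by
  obtain ⟨i, hiS, hi⟩ := Finset.exists_mem_eq_sup' hS r
  obtain ⟨m, rfl⟩ := σ.surjective i
  let g : ℕ → ℝ := fun k => if h : k < n then r (σ ⟨k, h⟩) else 0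
  have hg (j : Fin n) : g j = r (σ j) := by simp [g]
  have hgn : g n = 0 := by simp [g]
  have hd (j : Fin n) : 0 ≤ g j - g (j + 1) := by
    rw [hg, sub_nonneg]
    by_cases h : (j : ℕ) + 1 < n
    · simpa [g, h] using hσ j ⟨j + 1, h⟩ (Fin.mk_le_mk.2 (Nat.le_succ _))
    · simpa [g, h] using hr (σ j)
  have hφ0 (i : Fin n) : 0 ≤ φ i := by
    rw [hφ]
    split_ifs <;> norm_num
  have hsum := sum_fin_ite_sub_succ m.isLt.le g
  rw [hgn, sub_zero, hg] at hsum
  rw [hi, ← hsum, Finset.mul_sum, ge_iff_le]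
  refine Finset.sum_le_sum fun j _ => ?_
  rw [← hg j]
  change _ ≤ (g j - g (j + 1)) * _
  split_ifs with hmj
  · have hone : 1 ≤ ∑ k ∈ Finset.Iic j, φ (σ k) := by
      have hle := Finset.single_le_sum (f := fun k => φ (σ k))
        (fun k _ => hφ0 (σ k)) (Finset.mem_Iic.2 (Fin.le_def.2 hmj))
      simpa [hφ (σ m), hiS] using hle
    rw [mul_comm]
    refine mul_le_mul_of_nonneg_left (sub_le_sub_left (Real.exp_le_exp.2 ?_) 1) (hd j)
    nlinarith
  · rw [mul_zero]
    refine mul_nonneg (hd j) (sub_nonneg.2 (Real.exp_le_one_iff.2 ?_))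
    exact mul_nonpos_of_nonpos_of_nonneg (neg_nonpos.2 hδ)
      (Finset.sum_nonneg fun k _ => hφ0 (σ k))
end
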